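/- arXiv:2410.20908 — 2 statements merged into one kernel-verified Lean document; each statement's English description precedes it below -/
import Mathlib

section
/- Let m ≥ 2, let Z₁, …, Z_m be real-valued random variables on a probability space, let α ∈ (0,1), and let c_B be a real number with P(|Z_k| > c_B) ≤ α/m for every k. Suppose there exist i ≠ j with P(|Z_i| > c_B and |Z_j| > c_B) > 0. If C is a real number with P(max_{k} |Z_k| > C) = α, then C < c_B. -/
open MeasureTheory

/-- Core of the Dunnett/Bonferroni comparison: if each `|Z k|` exceeds the
Bonferroni cutoff `c_B` with probability at most `α/m`, two of these
exceedance events overlap with positive probability, and `C` is calibrated so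
that the maximum statistic exceeds it with probability exactly `α`, then
`C < c_B`. -/
theorem stmt4 {Ω : Type*} [MeasurableSpace Ω] (μ : Measure Ω) [IsProbabilityMeasure μ]
    (m : ℕ) (hm : 2 ≤ m) (Z : Fin m → Ω → ℝ)
    (α : ℝ) (hα : α ∈ Set.Ioo (0 : ℝ) 1) (cB : ℝ)
    (hB : ∀ k, μ {ω | cB < |Z k ω|} ≤ ENNReal.ofReal (α / m))
    (hoverlap : ∃ i j : Fin m, i ≠ j ∧ 0 < μ {ω | cB < |Z i ω| ∧ cB < |Z j ω|})
    (hne : (Finset.univ : Finset (Fin m)).Nonempty) (C : ℝ)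
    (hC : μ {ω | C < Finset.univ.sup' hne fun k => |Z k ω|} = ENNReal.ofReal α) :
    C < cB := by
  by_contra hlt
  have hle : cB ≤ C := not_lt.mp hlt
  obtain ⟨i, j, hij, hpos⟩ := hoverlap
  set A : Fin m → Set Ω := fun k => {ω | cB < |Z k ω|} with hA
  have hm0 : (m : ℝ) ≠ 0 := by positivity
  -- strong subadditivity of the outer measure, via measurable hulls
  have hstrong : μ (A i ∪ A j) + μ (A i ∩ A j) ≤ μ (A i) + μ (A j) := by
    calc μ (A i ∪ A j) + μ (A i ∩ A j)
        ≤ μ (toMeasurable μ (A i) ∪ toMeasurable μ (A j))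
          + μ (toMeasurable μ (A i) ∩ toMeasurable μ (A j)) :=
          add_le_add
            (measure_mono (Set.union_subset_union (subset_toMeasurable _ _)
              (subset_toMeasurable _ _)))
            (measure_mono (Set.inter_subset_inter (subset_toMeasurable _ _)
              (subset_toMeasurable _ _)))
      _ = μ (A i) + μ (A j) := by
          rw [measure_union_add_inter _ (measurableSet_toMeasurable _ _),
            measure_toMeasurable, measure_toMeasurable]
  let S : Finset (Fin m) := (Finset.univ.erase i).erase j
  have hsub : {ω | C < Finset.univ.sup' hne fun k => |Z k ω|}
      ⊆ (A i ∪ A j) ∪ ⋃ k ∈ S, A k := by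
    intro ω hω
    rw [Set.mem_setOf_eq, Finset.lt_sup'_iff] at hω
    obtain ⟨k, -, hk⟩ := hω
    have hkA : ω ∈ A k := lt_of_le_of_lt hle hk
    by_cases h1 : k = i
    · subst h1; exact Or.inl (Or.inl hkA)
    by_cases h2 : k = j
    · subst h2; exact Or.inl (Or.inr hkA)
    · exact Or.inr (Set.mem_biUnion (by simp [S, h1, h2]) hkA)
  have hjm : j ∈ Finset.univ.erase i := by simp [hij.symm]
  have hsum : ∑ k, μ (A k) = μ (A i) + (μ (A j) + ∑ k ∈ S, μ (A k)) := by
    rw [← Finset.add_sum_erase _ _ (Finset.mem_univ i), ← Finset.add_sum_erase _ _ hjm]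
  have htot : ∑ k, μ (A k) ≤ ENNReal.ofReal α := by
    calc ∑ k, μ (A k) ≤ ∑ _k : Fin m, ENNReal.ofReal (α / m) :=
          Finset.sum_le_sum fun k _ => hB k
      _ = ENNReal.ofReal α := by
          rw [Finset.sum_const, Finset.card_univ, Fintype.card_fin, ← ENNReal.ofReal_nsmul,
            nsmul_eq_mul, mul_div_cancel₀ _ hm0]
  have hkey : ENNReal.ofReal α + μ (A i ∩ A j) ≤ ENNReal.ofReal α := by
    calc ENNReal.ofReal α + μ (A i ∩ A j)
        ≤ (μ (A i ∪ A j) + ∑ k ∈ S, μ (A k)) + μ (A i ∩ A j) := by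
          gcongr
          rw [← hC]
          exact (measure_mono hsub).trans ((measure_union_le _ _).trans
            (add_le_add le_rfl (measure_biUnion_finset_le _ _)))
      _ = (μ (A i ∪ A j) + μ (A i ∩ A j)) + ∑ k ∈ S, μ (A k) := by ring
      _ ≤ (μ (A i) + μ (A j)) + ∑ k ∈ S, μ (A k) := by gcongr
      _ = ∑ k, μ (A k) := by rw [hsum, add_assoc]
      _ ≤ ENNReal.ofReal α := htot
  have hpos' : μ (A i ∩ A j) ≠ 0 := hpos.ne'
  exact absurd hkey (not_le.mpr (ENNReal.lt_add_right ENNReal.ofReal_ne_top hpos'))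
end

section
/- Let K ≥ 3, let δ > 0, let τ > 0, and for a mean vector μ = (μ₁,…,μ_K) ∈ ℝ^K let G₁,…,G_K be independent real-valued random variables with G_i Gaussian with mean μ_i and variance τ. For C > 0 let p(μ) = P(∃ i < j : |G_i − G_j| > C√(2τ)). Then among all μ with μ₁ = δ and μ₂ = 0, the function p(μ) is minimized at the configuration μ_i = δ/2 for all i = 3,…,K. -/
open MeasureTheory ProbabilityTheory
open scoped NNReal ENNReal

/-- One-dimensional Brunn–Minkowski for compact sets (midpoint form). -/
lemma bm_compact {A B S : Set ℝ} (hA : IsCompact A) (hB : IsCompact B)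
    (hAn : A.Nonempty) (hBn : B.Nonempty)
    (hS : ∀ a ∈ A, ∀ b ∈ B, (a + b) / 2 ∈ S) :
    volume A + volume B ≤ 2 * volume S := by
  have ha := hA.sSup_mem hAn
  have hb := hB.sInf_mem hBn
  have hle : ∀ x ∈ A, x ≤ sSup A := fun x hx => le_csSup hA.bddAbove hx
  have hge : ∀ x ∈ B, sInf B ≤ x := fun x hx => csInf_le hB.bddBelow hx
  set a := sSup A
  set b := sInf B
  have hS2 : volume ((fun x => (1/2 : ℝ) * x) ⁻¹' S) = 2 * volume S := by
    rw [Real.volume_preimage_mul_left (by norm_num)]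
    norm_num
  have e1 : volume ((fun x => x + (-b)) ⁻¹' A) = volume A := measure_preimage_add_right _ _ _
  have e2 : volume ((fun x => x + (-a)) ⁻¹' B) = volume B := measure_preimage_add_right _ _ _
  rw [← hS2, ← e1, ← e2, ← measure_union₀]
  · apply measure_mono
    rintro x (hx | hx)
    · have := hS _ hx _ hb
      simp only [Set.mem_preimage]
      convert this using 1
      ring
    · have := hS _ ha _ hx
      simp only [Set.mem_preimage]
      convert this using 1
      ring
  · exact (hB.measurableSet.preimage (by fun_prop)).nullMeasurableSet
  · refine measure_mono_null (t := {a + b}) ?_ (by simp)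
    rintro x ⟨hx, hy⟩
    have h1 := hle _ hx
    have h2 := hge _ hy
    simp only [Set.mem_singleton_iff]
    linarith

/-- One-dimensional Brunn–Minkowski (midpoint form). -/
lemma bm_meas {A B S : Set ℝ} (hA : MeasurableSet A) (hB : MeasurableSet B)
    (hAn : A.Nonempty) (hBn : B.Nonempty)
    (hS : ∀ a ∈ A, ∀ b ∈ B, (a + b) / 2 ∈ S) :
    volume A + volume B ≤ 2 * volume S := by
  obtain ⟨a, ha⟩ := hAn
  obtain ⟨b, hb⟩ := hBn
  rw [hA.measure_eq_iSup_isCompact, hB.measure_eq_iSup_isCompact]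
  simp only [iSup_and']
  refine ENNReal.biSup_add_biSup_le' ⟨∅, by simp⟩ ⟨∅, by simp⟩ ?_
  rintro K ⟨hKA, hK⟩ L ⟨hLB, hL⟩
  refine le_trans (add_le_add (measure_mono (Set.subset_insert a K))
    (measure_mono (Set.subset_insert b L))) ?_
  refine bm_compact (hK.insert a) (hL.insert b) (Set.insert_nonempty _ _)
    (Set.insert_nonempty _ _) ?_
  intro x hx y hy
  exact hS x (Set.insert_subset ha hKA hx) y (Set.insert_subset hb hLB hy)

lemma pl_norm {f g : ℝ → ℝ} {h : ℝ → ℝ≥0∞} (hf : Measurable f) (hg : Measurable g)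
    (hh : Measurable h) (f0 : ∀ x, 0 ≤ f x) (g0 : ∀ x, 0 ≤ g x)
    (f1 : ∀ x, f x ≤ 1) (g1 : ∀ x, g x ≤ 1)
    (fs : ∀ t < 1, ∃ x, t < f x) (gs : ∀ t < 1, ∃ x, t < g x)
    (H : ∀ x y, ENNReal.ofReal (f x) * ENNReal.ofReal (g y) ≤ h ((x + y) / 2) ^ 2) :
    (∫⁻ x, ENNReal.ofReal (f x)) + (∫⁻ x, ENNReal.ofReal (g x)) ≤ 2 * ∫⁻ x, h x := by
  set k : ℝ → ℝ := fun z => (min (h z) 1).toReal with hk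
  have kfin : ∀ z, min (h z) 1 ≠ ∞ := fun z => ne_top_of_le_ne_top ENNReal.one_ne_top (min_le_right _ _)
  have kle : (∫⁻ x, ENNReal.ofReal (k x)) ≤ ∫⁻ x, h x := by
    apply lintegral_mono
    intro z
    simp only [hk]
    rw [ENNReal.ofReal_toReal (kfin z)]
    exact min_le_left _ _
  have km : Measurable k := (hh.min measurable_const).ennreal_toReal
  refine le_trans ?_ (mul_le_mul_right kle 2)
  have anti : ∀ u : ℝ → ℝ, Measurable fun t : ℝ => volume {a : ℝ | t < u a} := by
    intro u
    apply Antitone.measurable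
    intro s t hst
    exact measure_mono fun a (ha : t < u a) => lt_of_le_of_lt hst ha
  rw [lintegral_eq_lintegral_meas_lt volume (ae_of_all _ f0) hf.aemeasurable,
    lintegral_eq_lintegral_meas_lt volume (ae_of_all _ g0) hg.aemeasurable,
    lintegral_eq_lintegral_meas_lt volume (ae_of_all _ fun z => ENNReal.toReal_nonneg) km.aemeasurable,
    ← lintegral_add_left (anti f), ← lintegral_const_mul _ (anti k)]
  refine setLIntegral_mono ((anti k).const_mul 2) ?_
  intro t ht
  have ht0 : 0 < t := ht
  by_cases ht1 : t < 1
  · refine bm_meas (hf measurableSet_Ioi) (hg measurableSet_Ioi) (fs t ht1) (gs t ht1) ?_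
    intro x hx y hy
    have hx' : t < f x := hx
    have hy' : t < g y := hy
    have h1 := H x y
    have h2 : ENNReal.ofReal t ^ 2 < h ((x + y) / 2) ^ 2 := by
      refine lt_of_lt_of_le ?_ h1
      rw [← ENNReal.ofReal_mul (f0 x), ← ENNReal.ofReal_pow ht0.le]
      rw [ENNReal.ofReal_lt_ofReal_iff (by nlinarith)]
      nlinarith
    have h3 := lt_of_not_ge fun hle => absurd h2 (not_lt.2 (pow_le_pow_left' hle 2))
    show t < (min (h ((x + y) / 2)) 1).toReal
    rw [← ENNReal.ofReal_lt_iff_lt_toReal ht0.le (kfin _)]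
    refine lt_min h3 ?_
    rw [← ENNReal.ofReal_one]
    exact (ENNReal.ofReal_lt_ofReal_iff one_pos).2 ht1
  · have e1 : {a : ℝ | t < f a} = ∅ := by
      ext z; simp only [Set.mem_ofPred_eq, Set.mem_empty_iff_false, iff_false]
      linarith [f1 z]
    have e2 : {a : ℝ | t < g a} = ∅ := by
      ext z; simp only [Set.mem_ofPred_eq, Set.mem_empty_iff_false, iff_false]
      linarith [g1 z]
    simp [e1, e2]

lemma sup_norm {f : ℝ → ℝ≥0∞} {a : ℝ≥0} (ha : 0 < a) (hs : ⨆ x, f x = a) :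
    (∀ x, f x = a * ENNReal.ofReal ((f x / a).toReal)) ∧ (∀ x, (f x / a).toReal ≤ 1) ∧
    ∀ t < (1:ℝ), ∃ x, t < (f x / a).toReal := by
  have ha' : (a : ℝ≥0∞) ≠ 0 := by exact_mod_cast ha.ne'
  have hle : ∀ x, f x ≤ a := fun x => hs ▸ le_iSup f x
  have hle1 : ∀ x, f x / a ≤ 1 := fun x => ENNReal.div_le_of_le_mul (by simpa using hle x)
  have hfin : ∀ x, f x / a ≠ ∞ := fun x => ne_top_of_le_ne_top ENNReal.one_ne_top (hle1 x)
  refine ⟨fun x => ?_, fun x => ?_, fun t ht => ?_⟩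
  · rw [ENNReal.ofReal_toReal (hfin x), ENNReal.mul_div_cancel ha' ENNReal.coe_ne_top]
  · exact ENNReal.toReal_le_of_le_ofReal zero_le_one (by simpa using hle1 x)
  · by_contra! hcon
    have ht0 : 0 ≤ t := ENNReal.toReal_nonneg.trans (hcon 0)
    have : (a : ℝ≥0∞) ≤ ENNReal.ofReal t * a := by
      conv_lhs => rw [← hs]
      refine iSup_le fun x => ?_
      have := (ENNReal.le_ofReal_iff_toReal_le (hfin x) ht0).2 (hcon x)
      exact (ENNReal.div_le_iff ha' ENNReal.coe_ne_top).1 this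
    have h2 : ENNReal.ofReal t * a < 1 * a := by
      refine ENNReal.mul_lt_mul_left ha' ENNReal.coe_ne_top ?_
      rw [← ENNReal.ofReal_one]
      exact (ENNReal.ofReal_lt_ofReal_iff one_pos).2 ht
    rw [one_mul] at h2
    exact absurd this (not_le.2 h2)

/-- One-dimensional Prékopa–Leindler inequality, `λ = 1/2`, bounded functions. -/
lemma pl_one {f g h : ℝ → ℝ≥0∞} (hf : Measurable f) (hg : Measurable g) (hh : Measurable h)
    (M : ℝ≥0) (fM : ∀ x, f x ≤ M) (gM : ∀ x, g x ≤ M)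
    (H : ∀ x y, f x * g y ≤ h ((x + y) / 2) ^ 2) :
    (∫⁻ x, f x) * (∫⁻ x, g x) ≤ (∫⁻ x, h x) ^ 2 := by
  obtain ⟨a, ha⟩ := Option.ne_none_iff_exists.1
    (ne_top_of_le_ne_top ENNReal.coe_ne_top (iSup_le fM))
  obtain ⟨b, hb⟩ := Option.ne_none_iff_exists.1
    (ne_top_of_le_ne_top ENNReal.coe_ne_top (iSup_le gM))
  rcases eq_or_ne a 0 with rfl | ha0
  · have : ∀ x, f x = 0 := fun x => by
      have := le_iSup f x
      rw [← ha] at this; simpa using this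
    simp [this]
  rcases eq_or_ne b 0 with rfl | hb0
  · have : ∀ x, g x = 0 := fun x => by
      have := le_iSup g x
      rw [← hb] at this; simpa using this
    simp [this]
  have ha1 : 0 < a := pos_iff_ne_zero.2 ha0
  have hb1 : 0 < b := pos_iff_ne_zero.2 hb0
  obtain ⟨fe, f1, fs⟩ := sup_norm ha1 ha.symm
  obtain ⟨ge, g1, gs⟩ := sup_norm hb1 hb.symm
  set f' : ℝ → ℝ := fun x => (f x / a).toReal
  set g' : ℝ → ℝ := fun x => (g x / b).toReal
  have mf' : Measurable f' := (hf.div_const _).ennreal_toReal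
  have mg' : Measurable g' := (hg.div_const _).ennreal_toReal
  set c : ℝ≥0 := NNReal.sqrt (a * b)
  have hc : c ^ 2 = a * b := NNReal.sq_sqrt _
  have hc0 : c ≠ 0 := by
    intro h0
    rw [h0] at hc
    have := mul_pos ha1 hb1
    rw [← hc] at this
    simp at this
  have hc0' : (c : ℝ≥0∞) ≠ 0 := by exact_mod_cast hc0
  have hce : (c : ℝ≥0∞) ^ 2 = a * b := by exact_mod_cast hc
  set h' : ℝ → ℝ≥0∞ := fun x => h x / c
  have he : ∀ x, h x = c * h' x := fun x => (ENNReal.mul_div_cancel hc0' ENNReal.coe_ne_top).symm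
  have mh' : Measurable h' := hh.div_const _
  have key := pl_norm mf' mg' mh' (fun _ => ENNReal.toReal_nonneg) (fun _ => ENNReal.toReal_nonneg)
    f1 g1 fs gs (fun x y => by
      have := H x y
      rw [fe x, ge y, he, mul_pow, hce, mul_mul_mul_comm] at this
      refine (ENNReal.mul_le_mul_iff_right ?_ ?_).1 this
      · rw [← hce]; exact pow_ne_zero _ hc0'
      · exact ENNReal.mul_ne_top ENNReal.coe_ne_top ENNReal.coe_ne_top)
  have ef : ∫⁻ x, f x = a * ∫⁻ x, ENNReal.ofReal (f' x) := by
    rw [← lintegral_const_mul _ mf'.ennreal_ofReal]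
    exact lintegral_congr fe
  have eg : ∫⁻ x, g x = b * ∫⁻ x, ENNReal.ofReal (g' x) := by
    rw [← lintegral_const_mul _ mg'.ennreal_ofReal]
    exact lintegral_congr ge
  have eh : ∫⁻ x, h x = c * ∫⁻ x, h' x := by
    rw [← lintegral_const_mul _ mh']
    exact lintegral_congr he
  rw [ef, eg, eh, mul_mul_mul_comm, mul_pow, hce]
  refine mul_le_mul_right ?_ _
  generalize (∫⁻ x, ENNReal.ofReal (f' x)) = u at key
  generalize (∫⁻ x, ENNReal.ofReal (g' x)) = v at key
  generalize (∫⁻ x, h' x) = w at key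
  rcases eq_or_ne w ∞ with rfl | hw
  · simp
  have h2w : 2 * w ≠ ∞ := ENNReal.mul_ne_top (by simp) hw
  have hu : u ≠ ∞ := ne_top_of_le_ne_top h2w (le_trans le_self_add key)
  have hv : v ≠ ∞ := ne_top_of_le_ne_top h2w (le_trans le_add_self key)
  lift u to ℝ≥0 using hu
  lift v to ℝ≥0 using hv
  lift w to ℝ≥0 using hw
  norm_cast at key ⊢
  rw [← NNReal.coe_le_coe] at key ⊢
  push_cast at key ⊢
  nlinarith [sq_nonneg ((u : ℝ) - v), u.2, v.2, w.2]

lemma pdf_mid (μ ν : ℝ) (v : ℝ≥0) (x y : ℝ) :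
    gaussianPDF μ v x * gaussianPDF ν v y ≤ gaussianPDF ((μ + ν) / 2) v ((x + y) / 2) ^ 2 := by
  unfold gaussianPDF
  rw [← ENNReal.ofReal_mul (gaussianPDFReal_nonneg _ _ _),
    ← ENNReal.ofReal_pow (gaussianPDFReal_nonneg _ _ _)]
  apply ENNReal.ofReal_le_ofReal
  unfold gaussianPDFReal
  rw [mul_mul_mul_comm, ← Real.exp_add, mul_pow, ← pow_two, ← Real.exp_nat_mul]
  refine mul_le_mul_of_nonneg_left (Real.exp_le_exp.2 ?_) (by positivity)
  rw [← add_div, ← mul_div_assoc]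
  refine div_le_div_of_nonneg_right ?_ (by positivity)
  push_cast
  nlinarith [sq_nonneg ((x - μ) - (y - ν))]

lemma pdf_bdd (v : ℝ≥0) : ∃ M : ℝ≥0, ∀ μ x, gaussianPDF μ v x ≤ M := by
  refine ⟨Real.toNNReal ((√(2 * Real.pi * v))⁻¹), fun μ x => ?_⟩
  unfold gaussianPDF gaussianPDFReal
  refine ENNReal.ofReal_le_ofReal ?_
  refine mul_le_of_le_one_right (by positivity) (Real.exp_le_one_iff.2 ?_)
  rw [neg_div]
  have : 0 ≤ (x - μ) ^ 2 / (2 * (v : ℝ)) := by positivity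
  linarith

lemma gauss_one {v : ℝ≥0} (hv : v ≠ 0) (μ ν : ℝ) {f g h : ℝ → ℝ≥0∞} (hf : Measurable f)
    (hg : Measurable g) (hh : Measurable h) (f1 : ∀ x, f x ≤ 1) (g1 : ∀ x, g x ≤ 1)
    (H : ∀ x y, f x * g y ≤ h ((x + y) / 2) ^ 2) :
    (∫⁻ x, f x ∂gaussianReal μ v) * (∫⁻ x, g x ∂gaussianReal ν v) ≤
      (∫⁻ x, h x ∂gaussianReal ((μ + ν) / 2) v) ^ 2 := by
  simp only [gaussianReal_of_var_ne_zero _ hv]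
  rw [lintegral_withDensity_eq_lintegral_mul _ (measurable_gaussianPDF _ _) hf,
    lintegral_withDensity_eq_lintegral_mul _ (measurable_gaussianPDF _ _) hg,
    lintegral_withDensity_eq_lintegral_mul _ (measurable_gaussianPDF _ _) hh]
  obtain ⟨M, hM⟩ := pdf_bdd v
  refine pl_one ((measurable_gaussianPDF _ _).mul hf) ((measurable_gaussianPDF _ _).mul hg)
    ((measurable_gaussianPDF _ _).mul hh) M ?_ ?_ ?_
  · intro x
    simpa using mul_le_mul' (hM μ x) (f1 x)
  · intro x
    simpa using mul_le_mul' (hM ν x) (g1 x)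
  · intro x y
    simp only [Pi.mul_apply]
    rw [mul_mul_mul_comm, mul_pow]
    exact mul_le_mul' (pdf_mid _ _ _ _ _) (H x y)

lemma pi_split {n : ℕ} (v : ℝ≥0) (μ : Fin (n + 1) → ℝ) {f : (Fin (n + 1) → ℝ) → ℝ≥0∞}
    (hf : Measurable f) :
    ∫⁻ x, f x ∂(Measure.pi fun i => gaussianReal (μ i) v) =
      ∫⁻ t, ∫⁻ z, f (Fin.cons t z) ∂(Measure.pi fun i : Fin n => gaussianReal (μ i.succ) v)
        ∂gaussianReal (μ 0) v := by
  have hp := measurePreserving_piFinSuccAbove (fun i => gaussianReal (μ i) v) 0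
  rw [← (hp.symm _).lintegral_comp hf, lintegral_prod _ (by fun_prop)]
  simp [MeasurableEquiv.piFinSuccAbove, Fin.insertNthEquiv]

lemma gauss_pi {v : ℝ≥0} (hv : v ≠ 0) (n : ℕ) : ∀ (μ ν : Fin n → ℝ)
    {f g h : (Fin n → ℝ) → ℝ≥0∞} (_ : Measurable f)
    (_ : Measurable g) (_ : Measurable h) (_ : ∀ x, f x ≤ 1) (_ : ∀ x, g x ≤ 1)
    (_ : ∀ x y, f x * g y ≤ h (fun i => (x i + y i) / 2) ^ 2),
    (∫⁻ x, f x ∂(Measure.pi fun i => gaussianReal (μ i) v)) *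
      (∫⁻ x, g x ∂(Measure.pi fun i => gaussianReal (ν i) v)) ≤
      (∫⁻ x, h x ∂(Measure.pi fun i => gaussianReal ((μ i + ν i) / 2) v)) ^ 2 := by
  induction n with
  | zero =>
    intro μ ν f g h hf hg hh f1 g1 H
    simp only [lintegral_unique, measure_univ, mul_one]
    convert H default default using 3
  | succ n ih =>
    intro μ ν f g h hf hg hh f1 g1 H
    have mc : Measurable fun p : ℝ × (Fin n → ℝ) => (Fin.cons p.1 p.2 : Fin (n + 1) → ℝ) := by
      rw [measurable_pi_iff]
      intro i
      refine Fin.cases ?_ (fun j => ?_) i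
      · simpa using measurable_fst
      · simp only [Fin.cons_succ]; fun_prop
    rw [pi_split v μ hf, pi_split v ν hg, pi_split v (fun i => (μ i + ν i) / 2) hh]
    have bd : ∀ (κ : Fin n → ℝ) {k : (Fin (n + 1) → ℝ) → ℝ≥0∞}, (∀ x, k x ≤ 1) → ∀ t : ℝ,
        ∫⁻ z, k (Fin.cons t z) ∂(Measure.pi fun i : Fin n => gaussianReal (κ i) v) ≤ 1 := by
      intro κ k hk t
      refine (lintegral_mono fun z => hk _).trans ?_
      simp
    refine gauss_one hv _ _ (hf.comp mc).lintegral_prod_right'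
      (hg.comp mc).lintegral_prod_right'
      (hh.comp mc).lintegral_prod_right' (bd _ f1) (bd _ g1) ?_
    intro s t
    refine ih _ _ (hf.comp (mc.comp measurable_prodMk_left)) (hg.comp (mc.comp measurable_prodMk_left))
      (hh.comp (mc.comp measurable_prodMk_left)) (fun _ => f1 _) (fun _ => g1 _) ?_
    intro x y
    refine (H _ _).trans (le_of_eq ?_)
    congr 2
    funext i
    refine Fin.cases ?_ (fun j => ?_) i <;> simp

/-- Least favourable configuration (Theorem 1): with `K ≥ 3` independent
Gaussian arms of common variance `τ` and rejection of the global intersection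
when some pairwise difference satisfies `|G i − G j| > C√(2τ)`, among all mean
vectors with `μ₁ = δ` and `μ₂ = 0` the rejection probability is minimized by
the configuration with all remaining means equal to `δ/2`. -/
theorem stmt9 (K : ℕ) (hK : 3 ≤ K) (δ : ℝ) (hδ : 0 < δ) (τ : ℝ≥0) (hτ : 0 < τ)
    (C : ℝ) (hC : 0 < C)
    (p : (Fin K → ℝ) → ℝ≥0∞)
    (hp : ∀ μv : Fin K → ℝ, p μv =
      (Measure.pi fun i => gaussianReal (μv i) τ)
        {x | ∃ i j : Fin K, i < j ∧ C * Real.sqrt (2 * τ) < |x i - x j|})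
    (μv : Fin K → ℝ)
    (h1 : μv ⟨0, by omega⟩ = δ) (h2 : μv ⟨1, by omega⟩ = 0) :
    p (fun i => if i.val = 0 then δ else if i.val = 1 then 0 else δ / 2) ≤ p μv := by
  set c := C * Real.sqrt (2 * τ)
  set R : Set (Fin K → ℝ) := {x | ∃ i j : Fin K, i < j ∧ c < |x i - x j|} with hR
  have hRo : IsOpen R := by
    have : R = ⋃ i : Fin K, ⋃ j : Fin K, {x | i < j ∧ c < |x i - x j|} := by
      ext x; simp [hR]
    rw [this]
    refine isOpen_iUnion fun i => isOpen_iUnion fun j => ?_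
    by_cases hij : i < j
    · simp only [hij, true_and]
      exact isOpen_lt (by fun_prop) (by fun_prop)
    · simp [hij]
  have hRm : MeasurableSet R := hRo.measurableSet
  have hmem : ∀ x : Fin K → ℝ, x ∈ Rᶜ ↔ ∀ i j, |x i - x j| ≤ c := by
    intro x
    simp only [hR, Set.mem_compl_iff, Set.mem_ofPred_eq, not_exists, not_and, not_lt]
    refine ⟨fun h i j => ?_, fun h i j _ => h i j⟩
    rcases lt_trichotomy i j with hij | rfl | hij
    · exact h i j hij
    · simp only [sub_self, abs_zero]; positivity
    · rw [abs_sub_comm]; exact h j i hij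
  set σ : Equiv.Perm (Fin K) := Equiv.swap ⟨0, by omega⟩ ⟨1, by omega⟩ with hσ
  set μ' : Fin K → ℝ := fun i => δ - μv (σ i) with hμ'
  have hmid : (fun i : Fin K => (μv i + μ' i) / 2) =
      fun i => if i.val = 0 then δ else if i.val = 1 then 0 else δ / 2 := by
    funext i
    simp only [hμ', hσ]
    by_cases h0 : i.val = 0
    · obtain rfl : i = (⟨0, lt_of_lt_of_le (by norm_num) hK⟩ : Fin K) := Fin.ext h0
      rw [Equiv.swap_apply_left, h1, h2]; simp
    · by_cases h1' : i.val = 1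
      · obtain rfl : i = (⟨1, lt_of_lt_of_le (by norm_num) hK⟩ : Fin K) := Fin.ext h1'
        rw [Equiv.swap_apply_right, h1, h2]; simp
      · rw [Equiv.swap_apply_of_ne_of_ne (fun h => h0 (by rw [h])) (fun h => h1' (by rw [h]))]
        simp [h0, h1']
  -- reflection symmetry
  have hsymm : (Measure.pi fun i => gaussianReal (μ' i) τ) Rᶜ =
      (Measure.pi fun i => gaussianReal (μv i) τ) Rᶜ := by
    have hmp := measurePreserving_arrowCongr' (fun i => gaussianReal (μv i) τ)
      (fun i => gaussianReal (μ' i) τ) σ (MeasurableEquiv.subLeft δ) (fun i => by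
        refine ⟨MeasurableEquiv.measurable _, ?_⟩
        have e : μ' (σ i) = δ - μv i := by
          simp only [hμ', hσ, Equiv.swap_apply_self]
        rw [e]
        exact gaussianReal_map_const_sub δ)
    rw [← hmp.measure_preimage hRm.compl.nullMeasurableSet]
    congr 1
    ext x
    rw [Set.mem_preimage, hmem, hmem]
    have ev : ∀ i, MeasurableEquiv.arrowCongr' σ (MeasurableEquiv.subLeft δ) x i = δ - x (σ.symm i) :=
      fun i => rfl
    simp only [ev]
    constructor
    · intro h i j
      have := h (σ j) (σ i)
      simpa using this
    · intro h i j
      have := h (σ.symm j) (σ.symm i)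
      simpa using this
  have hconv : ∀ x y : Fin K → ℝ, x ∈ Rᶜ → y ∈ Rᶜ → (fun i => (x i + y i) / 2) ∈ Rᶜ := by
    intro x y hx hy
    rw [hmem] at *
    intro i j
    have a := abs_le.1 (hx i j)
    have b := abs_le.1 (hy i j)
    rw [abs_le]
    constructor <;> linarith [a.1, a.2, b.1, b.2]
  have mi : Measurable (Rᶜ.indicator (1 : (Fin K → ℝ) → ℝ≥0∞)) := measurable_one.indicator hRm.compl
  have le1 : ∀ x, Rᶜ.indicator (1 : (Fin K → ℝ) → ℝ≥0∞) x ≤ 1 :=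
    fun x => Set.indicator_le_self' (fun _ _ => zero_le) x
  have key := gauss_pi hτ.ne' K μv μ' mi mi mi le1 le1 (by
    intro x y
    by_cases hx : x ∈ Rᶜ
    · by_cases hy : y ∈ Rᶜ
      · rw [Set.indicator_of_mem hx, Set.indicator_of_mem hy, Set.indicator_of_mem (hconv x y hx hy)]
        simp
      · rw [Set.indicator_of_notMem hy]; simp
    · rw [Set.indicator_of_notMem hx]; simp)
  rw [lintegral_indicator_one hRm.compl, lintegral_indicator_one hRm.compl,
    lintegral_indicator_one hRm.compl, hsymm, ← pow_two] at key
  have key2 := le_of_not_gt fun hlt => absurd (ENNReal.pow_lt_pow_left two_ne_zero hlt) (not_lt.2 key)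
  rw [← hmid, hp, hp]
  have cmp : ∀ κ : Fin K → ℝ, (Measure.pi fun i => gaussianReal (κ i) τ) R =
      1 - (Measure.pi fun i => gaussianReal (κ i) τ) Rᶜ := by
    intro κ
    rw [← prob_compl_eq_one_sub hRm.compl, compl_compl]
  rw [cmp, cmp]
  exact tsub_le_tsub_left key2 1
end
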